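/- Let d ≥ 2 and let a₁, a₂ : Set.Icc (0:ℝ) 1 → (Fin (d−1) → ℂ) be continuous with a₁ 0 = a₂ 0, such that for every t the critical value multisets agree: cvl(p_{a₁ t}) = cvl(p_{a₂ t}), and such that the shape of cvl(p_{a₁ t}) is weakly increasing in time: for all s ≤ t in Set.Icc (0:ℝ) 1, the shape of cvl(p_{a₁ t}) is a merge of the shape of cvl(p_{a₁ s}). Then a₁ = a₂. (A multiset path of critical values with weakly increasing shape has a unique lift through the Lyashko–Looijenga map with a given polynomial start point.) -/

import Mathlib

open Polynomial

/-- The monic centered polynomial `X^d + ∑_{i=0}^{d-2} (a i)·X^i` determined by the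
coefficient vector `a`. -/
noncomputable def mcPoly (d : ℕ) (a : Fin (d - 1) → ℂ) : ℂ[X] :=
  X ^ d + ∑ i : Fin (d - 1), C (a i) * X ^ (i : ℕ)

/-- The critical value multiset of a polynomial: the multiset of values of `p` at the
roots (with multiplicity) of its derivative. -/
noncomputable def cvl (p : ℂ[X]) : Multiset ℂ :=
  Multiset.map (fun z => p.eval z) p.derivative.roots

/-- The shape of a finite multiset: the multiset of multiplicities of its distinct
elements. -/
noncomputable def mshape {X : Type*} (M : Multiset X) : Multiset ℕ :=
  letI := Classical.decEq X
  Multiset.map (fun a => M.count a) M.toFinset.val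

/-- `IsMergeOf μ lam` means `μ` is obtained from `lam` by grouping its entries and
replacing each (nonempty) group by its sum. -/
def IsMergeOf (μ lam : Multiset ℕ) : Prop :=
  ∃ m : Multiset (Multiset ℕ), (∀ s ∈ m, s ≠ 0) ∧ m.join = lam ∧
    Multiset.map Multiset.sum m = μ


open Filter Topology

/-- Coefficientwise convergence of a family of polynomials of bounded degree. -/
def CoeffTendsto {ι : Type*} (P : ι → ℂ[X]) (l : Filter ι) (Q : ℂ[X]) : Prop :=
  (∃ D, ∀ i, (P i).natDegree ≤ D) ∧
    ∀ k, Tendsto (fun i => (P i).coeff k) l (𝓝 (Q.coeff k))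

namespace CoeffTendsto

variable {ι : Type*} {l : Filter ι} {P : ι → ℂ[X]} {Q : ℂ[X]}

theorem exists_bound [l.NeBot] (h : CoeffTendsto P l Q) :
    ∃ D, (∀ i, (P i).natDegree ≤ D) ∧ Q.natDegree ≤ D := by
  obtain ⟨⟨D, hD⟩, hc⟩ := h
  refine ⟨D, hD, natDegree_le_iff_coeff_eq_zero.2 fun k hk => ?_⟩
  refine tendsto_nhds_unique (hc k) ?_
  simp only [fun i => coeff_eq_zero_of_natDegree_lt ((hD i).trans_lt hk)]
  exact tendsto_const_nhds

theorem sub_C (h : CoeffTendsto P l Q) {w : ι → ℂ} {v : ℂ} (hw : Tendsto w l (𝓝 v)) :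
    CoeffTendsto (fun i => P i - C (w i)) l (Q - C v) := by
  obtain ⟨⟨D, hD⟩, hc⟩ := h
  refine ⟨⟨D, fun i => ?_⟩, fun k => ?_⟩
  · rw [natDegree_sub_C]; exact hD i
  · simp only [coeff_sub, coeff_C]
    split_ifs
    · exact (hc k).sub hw
    · exact (hc k).sub tendsto_const_nhds

theorem derivative (h : CoeffTendsto P l Q) :
    CoeffTendsto (fun i => (P i).derivative) l Q.derivative := by
  obtain ⟨⟨D, hD⟩, hc⟩ := h
  refine ⟨⟨D, fun i => (natDegree_derivative_le _).trans (by have := hD i; omega)⟩, fun k => ?_⟩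
  simp only [coeff_derivative]
  exact (hc _).mul_const _

theorem iterate_derivative (h : CoeffTendsto P l Q) (n : ℕ) :
    CoeffTendsto (fun i => Polynomial.derivative^[n] (P i)) l (Polynomial.derivative^[n] Q) := by
  induction n with
  | zero => exact h
  | succ n ih => simpa only [Function.iterate_succ_apply'] using ih.derivative

theorem eval [l.NeBot] (h : CoeffTendsto P l Q) {x : ι → ℂ} {c : ℂ} (hx : Tendsto x l (𝓝 c)) :
    Tendsto (fun i => (P i).eval (x i)) l (𝓝 (Q.eval c)) := by
  obtain ⟨D, hD, hQ⟩ := h.exists_bound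
  simp only [fun i => eval_eq_sum_range' (Nat.lt_succ_of_le (hD i)) (x i),
    eval_eq_sum_range' (Nat.lt_succ_of_le hQ) c]
  exact tendsto_finsetSum _ fun k _ => (h.2 k).mul (hx.pow k)

theorem coeff_divByMonic_X_sub_C_of_le (p : ℂ[X]) (a : ℂ) (n D : ℕ) (hD : p.natDegree ≤ D) :
    (p /ₘ (X - C a)).coeff n = ∑ i ∈ Finset.Icc (n + 1) D, a ^ (i - (n + 1)) * p.coeff i := by
  rw [coeff_divByMonic_X_sub_C]
  refine Finset.sum_subset (Finset.Icc_subset_Icc_right hD) fun i hi hi' => ?_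
  rw [coeff_eq_zero_of_natDegree_lt, mul_zero]
  simp only [Finset.mem_Icc] at hi hi'
  omega

theorem divByMonic [l.NeBot] (h : CoeffTendsto P l Q) {x : ι → ℂ} {c : ℂ}
    (hx : Tendsto x l (𝓝 c)) :
    CoeffTendsto (fun i => P i /ₘ (X - C (x i))) l (Q /ₘ (X - C c)) := by
  obtain ⟨D, hD, hQ⟩ := h.exists_bound
  refine ⟨⟨D, fun i => ?_⟩, fun k => ?_⟩
  · rw [natDegree_divByMonic _ (monic_X_sub_C _)]
    exact (Nat.sub_le _ _).trans (hD i)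
  · simp only [fun i => coeff_divByMonic_X_sub_C_of_le (P i) (x i) k D (hD i),
      coeff_divByMonic_X_sub_C_of_le Q c k D hQ]
    exact tendsto_finsetSum _ fun j _ => (hx.pow _).mul (h.2 j)

theorem X_sub_C_dvd [l.NeBot] (h : CoeffTendsto P l Q) {x : ι → ℂ} {c : ℂ}
    (hx : Tendsto x l (𝓝 c)) (hd : ∀ᶠ i in l, (X - C (x i)) ∣ P i) : (X - C c) ∣ Q := by
  rw [dvd_iff_isRoot]
  refine tendsto_nhds_unique (h.eval hx) (tendsto_const_nhds.congr' ?_)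
  filter_upwards [hd] with i hi
  exact (dvd_iff_isRoot.1 hi).symm

theorem prod_X_sub_C_dvd [l.NeBot] {J : Type*} {z : ι → J → ℂ} {c : J → ℂ}
    (hz : ∀ j, Tendsto (fun i => z i j) l (𝓝 (c j))) (s : Multiset J)
    (h : CoeffTendsto P l Q) (hd : ∀ᶠ i in l, (s.map fun j => X - C (z i j)).prod ∣ P i) :
    (s.map fun j => X - C (c j)).prod ∣ Q := by
  induction s using Multiset.induction_on generalizing P Q with
  | empty => simp
  | cons j s ih =>
    simp only [Multiset.map_cons, Multiset.prod_cons] at hd ⊢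
    have h1 := h.X_sub_C_dvd (hz j) (hd.mono fun i hi => (dvd_mul_right _ _).trans hi)
    rw [← mul_divByMonic_eq_iff_isRoot.2 (dvd_iff_isRoot.1 h1)]
    refine mul_dvd_mul_left _ (ih (h.divByMonic (hz j)) ?_)
    filter_upwards [hd] with i hi
    obtain ⟨r, hr⟩ := hi
    rw [hr, mul_assoc, mul_divByMonic_cancel_left _ (monic_X_sub_C _)]
    exact dvd_mul_right _ _

/-- Roots of a convergent family with constant leading term stay bounded. -/
theorem exists_root_bound {n : ℕ} (h : CoeffTendsto P l Q)
    (hP : ∀ i, (P i).natDegree = n) (hP0 : ∀ i, P i ≠ 0)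
    (hlead : ∀ i, (P i).leadingCoeff = Q.leadingCoeff) :
    ∃ M : ℝ, ∀ᶠ i in l, ∀ x, (P i).IsRoot x → ‖x‖ ≤ M := by
  have ht : Tendsto (fun i => cauchyBound (P i)) l
      (𝓝 ((Finset.range n).sup (fun k => ‖Q.coeff k‖₊) / ‖Q.leadingCoeff‖₊ + 1)) := by
    simp only [cauchyBound, hlead, hP]
    refine (Tendsto.div_const ?_ _).add_const _
    exact Tendsto.finset_sup_nhds_apply fun k _ => (h.2 k).nnnorm
  refine ⟨((Finset.range n).sup (fun k => ‖Q.coeff k‖₊) / ‖Q.leadingCoeff‖₊ + 1 + 1 :), ?_⟩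
  filter_upwards [ht.eventually_le_const (lt_add_one _)] with i hi x hx
  have := (hx.norm_lt_cauchyBound (hP0 i)).le.trans hi
  exact_mod_cast this

end CoeffTendsto

theorem eventually_ne_of_tendsto {ι : Type*} {l : Filter ι} {x y : ι → ℂ} {a b : ℂ}
    (hx : Tendsto x l (𝓝 a)) (hy : Tendsto y l (𝓝 b)) (hab : a ≠ b) : ∀ᶠ i in l, x i ≠ y i :=
  ((hx.sub hy).eventually_ne (sub_ne_zero.2 hab)).mono fun _ hi => sub_ne_zero.1 hi

/-- A family of finite sets with at most as many elements as a finite set `V₀`, all of whose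
points are approached, has asymptotically only one element near each point of `V₀`. -/
theorem eventually_eq_of_card_le {ι : Type*} {l : Filter ι} {V : ι → Finset ℂ} {V₀ : Finset ℂ}
    (hcard : ∀ᶠ i in l, (V i).card ≤ V₀.card) {x : ℂ → ι → ℂ}
    (hxV : ∀ v ∈ V₀, ∀ᶠ i in l, x v i ∈ V i) (hx : ∀ v ∈ V₀, Tendsto (x v) l (𝓝 v))
    {y : ι → ℂ} {v : ℂ} (hyV : ∀ᶠ i in l, y i ∈ V i) (hy : Tendsto y l (𝓝 v)) :
    ∀ᶠ i in l, y i = x v i := by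
  have hinj : ∀ᶠ i in l, ∀ v ∈ V₀, ∀ v' ∈ V₀, v ≠ v' → x v i ≠ x v' i := by
    simp only [eventually_all_finset]
    intro a ha b hb
    by_cases hne : a = b
    · simp [hne]
    · exact (eventually_ne_of_tendsto (hx a ha) (hx b hb) hne).mono fun i hi _ => hi
  have hsep : ∀ᶠ i in l, ∀ v' ∈ V₀, v ≠ v' → y i ≠ x v' i := by
    simp only [eventually_all_finset]
    intro v' hv'
    by_cases hne : v = v'
    · simp [hne]
    · exact (eventually_ne_of_tendsto hy (hx v' hv') hne).mono fun i hi _ => hi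
  have hmem : ∀ᶠ i in l, ∀ v ∈ V₀, x v i ∈ V i := by
    simpa only [eventually_all_finset] using hxV
  filter_upwards [hinj, hsep, hmem, hcard, hyV] with i h1 h2 h3 h4 h5
  have himg : V₀.image (fun v => x v i) = V i := by
    refine Finset.eq_of_subset_of_card_le (Finset.image_subset_iff.2 h3) ?_
    rwa [Finset.card_image_of_injOn]
    intro a ha b hb hab
    by_contra hne
    exact h1 a ha b hb hne hab
  rw [← himg, Finset.mem_image] at h5
  obtain ⟨v', hv', he⟩ := h5
  by_contra hne
  refine h2 v' hv' ?_ he.symm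
  rintro rfl
  exact hne he.symm

theorem Multiset.exists_fin_map_eq {X : Type*} (s : Multiset X) {n : ℕ}
    (hs : Multiset.card s = n) : ∃ z : Fin n → X, (Finset.univ.val.map z : Multiset X) = s := by
  induction s using Quotient.inductionOn with
  | h L =>
    simp only [Multiset.quot_mk_to_coe, Multiset.coe_card] at hs
    subst hs
    exact ⟨L.get, by simp [Fin.univ_val_map]⟩

/-- Along an ultrafilter, the roots of a convergent family of polynomials with constant leading
term can be numbered so that they converge to the roots of the limit. -/
theorem CoeffTendsto.exists_root_tuple {ι : Type*} {U : Ultrafilter ι} {P : ι → ℂ[X]} {Q : ℂ[X]}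
    {n : ℕ} (h : CoeffTendsto P U Q) (hP : ∀ i, (P i).natDegree = n) (hQ : Q.natDegree = n)
    (hQ0 : Q ≠ 0) (hlead : ∀ i, (P i).leadingCoeff = Q.leadingCoeff) :
    ∃ (z : ι → Fin n → ℂ) (z₀ : Fin n → ℂ),
      (∀ i, Finset.univ.val.map (z i) = (P i).roots) ∧
      (∀ j, Tendsto (fun i => z i j) U (𝓝 (z₀ j))) ∧ Finset.univ.val.map z₀ = Q.roots := by
  have hP0 : ∀ i, P i ≠ 0 := fun i => by
    rw [← leadingCoeff_ne_zero, hlead, leadingCoeff_ne_zero]; exact hQ0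
  have hcard : ∀ p : ℂ[X], p.natDegree = n → Multiset.card p.roots = n := fun p hp => by
    rw [← (IsAlgClosed.splits p).natDegree_eq_card_roots, hp]
  choose z hz using fun i => (P i).roots.exists_fin_map_eq (hcard _ (hP i))
  obtain ⟨M, hM⟩ := h.exists_root_bound hP hP0 hlead
  have hlim : ∀ j, ∃ x, Tendsto (fun i => z i j) U (𝓝 x) := by
    intro j
    obtain ⟨x, -, hx⟩ := (isCompact_closedBall (0 : ℂ) M).ultrafilter_le_nhds
      (U.map fun i => z i j) (by
        rw [le_principal_iff]
        change ∀ᶠ i in U, z i j ∈ Metric.closedBall (0 : ℂ) M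
        filter_upwards [hM] with i hi
        rw [mem_closedBall_zero_iff]
        refine hi _ (isRoot_of_mem_roots ?_)
        rw [← hz]
        exact Multiset.mem_map_of_mem _ (Finset.mem_univ j))
    exact ⟨x, hx⟩
  choose z₀ hz₀ using hlim
  refine ⟨z, z₀, hz, hz₀, Multiset.eq_of_le_of_card_le ?_ ?_⟩
  · rw [← Multiset.prod_X_sub_C_dvd_iff_le_roots hQ0, Multiset.map_map]
    refine h.prod_X_sub_C_dvd hz₀ _ (Eventually.of_forall fun i => ?_)
    have := (Multiset.prod_X_sub_C_dvd_iff_le_roots (hP0 i) _).2 (hz i).le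
    rwa [Multiset.map_map] at this
  · rw [hcard Q hQ]; simp

theorem sub_C_ne_zero_of_derivative_ne_zero {p : ℂ[X]} (hp : p.derivative ≠ 0) (w : ℂ) :
    p - C w ≠ 0 := by
  intro h
  rw [sub_eq_zero.1 h, derivative_C] at hp
  exact hp rfl

theorem count_roots_sub_C_of_eval_eq {p : ℂ[X]} {x w : ℂ} (hx : p.eval x = w)
    (hp : p.derivative ≠ 0) :
    (p - C w).roots.count x = p.derivative.roots.count x + 1 := by
  have hr : (p - C w).IsRoot x := by simp [hx]
  have h1 := derivative_rootMultiplicity_of_root hr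
  have h2 := (rootMultiplicity_pos (sub_C_ne_zero_of_derivative_ne_zero hp w)).2 hr
  rw [derivative_sub, derivative_C, sub_zero] at h1
  rw [count_roots, count_roots]
  omega

/-- A group of critical points with a common critical value `w`, two of which are distinct, gives
at least two more roots of `p - w` than it has members. -/
theorem cons_cons_le_roots_sub_C {p : ℂ[X]} (hp : p.derivative ≠ 0) {w : ℂ} {s : Multiset ℂ}
    (hs : s ≤ p.derivative.roots) (hw : ∀ x ∈ s, p.eval x = w) {a b : ℂ} (ha : a ∈ s) (hb : b ∈ s)
    (hab : a ≠ b) : a ::ₘ b ::ₘ s ≤ (p - C w).roots := by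
  rw [Multiset.le_iff_count]
  intro x
  by_cases hx : x ∈ s
  · rw [count_roots_sub_C_of_eval_eq (hw x hx) hp, Multiset.count_cons, Multiset.count_cons]
    have := Multiset.le_iff_count.1 hs x
    split_ifs with h1 h2
    · exact absurd (h1.symm.trans h2) hab.symm
    all_goals omega
  · have hxa : x ≠ a := fun h => hx (h ▸ ha)
    have hxb : x ≠ b := fun h => hx (h ▸ hb)
    simp [hxa, hxb, hx]

/-- If the number of critical values does not exceed that of the limit, then the critical points
near a critical point `c` of the limit coalesce into a single one, of the same multiplicity. -/
theorem CoeffTendsto.exists_critical_point {ι : Type*} {U : Ultrafilter ι} {P : ι → ℂ[X]}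
    {Q : ℂ[X]} {n : ℕ} (h : CoeffTendsto P U Q) (hP : ∀ i, (P i).Monic)
    (hPn : ∀ i, (P i).natDegree = n + 1) (hQ : Q.Monic) (hQn : Q.natDegree = n + 1)
    (hcard : ∀ᶠ i in U, (cvl (P i)).toFinset.card ≤ (cvl Q).toFinset.card)
    {c : ℂ} (hc : c ∈ Q.derivative.roots) :
    ∃ φ : ι → ℂ, Tendsto φ U (𝓝 c) ∧ ∀ᶠ i in U, φ i ∈ (P i).derivative.roots ∧
      (X - C (φ i)) ^ (Q.derivative.rootMultiplicity c + 1) ∣ P i - C ((P i).eval (φ i)) := by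
  have hdQ : Q.derivative ≠ 0 := derivative_ne_zero.2 (by omega)
  have hdP : ∀ i, (P i).derivative ≠ 0 := fun i => derivative_ne_zero.2 (by rw [hPn]; omega)
  obtain ⟨z, z₀, hz, hlim, hz₀⟩ := h.derivative.exists_root_tuple (n := n)
    (fun i => by simp [natDegree_derivative, hPn]) (by simp [natDegree_derivative, hQn]) hdQ
    (fun i => by simp [hPn, hQn, (hP i).leadingCoeff, hQ.leadingCoeff])
  have hzmem : ∀ i j, z i j ∈ (P i).derivative.roots := fun i j => by
    rw [← hz]; exact Multiset.mem_map_of_mem _ (Finset.mem_univ j)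
  have hval : ∀ v ∈ (cvl Q).toFinset, ∃ j, Q.eval (z₀ j) = v := by
    intro v hv
    rw [Multiset.mem_toFinset, cvl, Multiset.mem_map] at hv
    obtain ⟨x, hx, rfl⟩ := hv
    rw [← hz₀, Multiset.mem_map] at hx
    obtain ⟨j, -, rfl⟩ := hx
    exact ⟨j, rfl⟩
  have hv : Q.eval c ∈ (cvl Q).toFinset := by
    rw [Multiset.mem_toFinset, cvl]
    exact Multiset.mem_map_of_mem _ hc
  have : Nonempty (Fin n) := (hval _ hv).nonempty
  choose! J hJ using hval
  have hcv : ∀ i j, (P i).eval (z i j) ∈ (cvl (P i)).toFinset := fun i j => by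
    rw [Multiset.mem_toFinset, cvl]
    exact Multiset.mem_map_of_mem _ (hzmem i j)
  have hsame : ∀ j, z₀ j = c → ∀ᶠ i in U, (P i).eval (z i j) = (P i).eval (z i (J (Q.eval c))) := by
    intro j hj
    refine eventually_eq_of_card_le (V := fun i => (cvl (P i)).toFinset) hcard
      (x := fun v i => (P i).eval (z i (J v)))
      (fun v _ => Eventually.of_forall fun i => hcv i _) (fun v hv => ?_)
      (Eventually.of_forall fun i => hcv i j) ?_
    · have := h.eval (hlim (J v))
      rwa [hJ v hv] at this
    · have := h.eval (hlim j)
      rwa [hj] at this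
  set I : Finset (Fin n) := Finset.univ.filter fun j => z₀ j = c with hI
  have hIcard : I.card = Q.derivative.rootMultiplicity c := by
    rw [← count_roots, ← hz₀, Multiset.count_map, hI, Finset.card_def, Finset.filter_val]
    simp only [eq_comm]
  have hIle : ∀ i, I.val.map (z i) ≤ (P i).derivative.roots := fun i => by
    rw [← hz]; exact Multiset.map_le_map (Finset.val_le_iff.2 (Finset.filter_subset _ _))
  have hcommon : ∀ᶠ i in U, ∀ j ∈ I, (P i).eval (z i j) = (P i).eval (z i (J (Q.eval c))) := by
    rw [eventually_all_finset]
    exact fun j hj => hsame j (Finset.mem_filter.1 hj).2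
  have hcoal : ∀ j₁ ∈ I, ∀ j₂ ∈ I, ∀ᶠ i in U, z i j₁ = z i j₂ := by
    intro j₁ hj₁ j₂ hj₂
    by_contra hne
    rw [← Ultrafilter.eventually_not] at hne
    have hw : Tendsto (fun i => (P i).eval (z i (J (Q.eval c)))) U (𝓝 (Q.eval c)) := by
      have := h.eval (hlim (J (Q.eval c)))
      rwa [hJ _ hv] at this
    have hd := (h.sub_C hw).prod_X_sub_C_dvd hlim (j₁ ::ₘ j₂ ::ₘ I.val) (by
      filter_upwards [hne, hcommon] with i hi hi'
      have := (Multiset.prod_X_sub_C_dvd_iff_le_roots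
        (sub_C_ne_zero_of_derivative_ne_zero (hdP i) _) _).2 (cons_cons_le_roots_sub_C (hdP i) (hIle i)
          (fun x hx => by
            obtain ⟨j, hj, rfl⟩ := Multiset.mem_map.1 hx
            exact hi' j hj) (Multiset.mem_map_of_mem (z i) hj₁)
          (Multiset.mem_map_of_mem (z i) hj₂) hi)
      rwa [← Multiset.map_cons, ← Multiset.map_cons, Multiset.map_map] at this)
    have hmap : (j₁ ::ₘ j₂ ::ₘ I.val).map (fun j => X - C (z₀ j)) =
        Multiset.replicate (I.card + 2) (X - C c) := by
      rw [Multiset.eq_replicate]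
      refine ⟨by simp, fun b hb => ?_⟩
      obtain ⟨j, hj, rfl⟩ := Multiset.mem_map.1 hb
      have hjI : j ∈ I := by
        rw [Multiset.mem_cons, Multiset.mem_cons] at hj
        rcases hj with rfl | rfl | hj <;> assumption
      rw [(Finset.mem_filter.1 hjI).2]
    rw [hmap, Multiset.prod_replicate,
      ← le_rootMultiplicity_iff (sub_C_ne_zero_of_derivative_ne_zero hdQ _),
      ← count_roots, count_roots_sub_C_of_eval_eq rfl hdQ, count_roots, hIcard] at hd
    omega
  obtain ⟨j, hj⟩ : I.Nonempty := by
    rw [← Finset.card_pos, hIcard, rootMultiplicity_pos hdQ]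
    exact isRoot_of_mem_roots hc
  refine ⟨fun i => z i j, ?_, ?_⟩
  · have := hlim j
    rwa [(Finset.mem_filter.1 hj).2] at this
  · have hall : ∀ᶠ i in U, ∀ j' ∈ I, z i j' = z i j := by
      rw [eventually_all_finset]
      exact fun j' hj' => hcoal j' hj' j hj
    filter_upwards [hall] with i hi
    refine ⟨hzmem i j, ?_⟩
    rw [← le_rootMultiplicity_iff (sub_C_ne_zero_of_derivative_ne_zero (hdP i) _),
      ← count_roots (P i - _), count_roots_sub_C_of_eval_eq rfl (hdP i)]
    have := Multiset.count_le_of_le (z i j) (hIle i)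
    rw [Multiset.map_congr rfl hi, Multiset.map_const', Multiset.count_replicate_self] at this
    rw [← hIcard]
    simpa using this

/-- If two convergent families with the same limit `Q` have roots `φ`, `ψ` of multiplicity `m + 1`
converging to a point at which `Q'` has a zero of order exactly `m`, then any limit of the
difference quotients of the families has a zero of order at least `m` there. -/
theorem CoeffTendsto.isRoot_iterate_derivative_of_dvd {ι : Type*} {l : Filter ι} [l.NeBot]
    {P P' F : ι → ℂ[X]} {Q G : ℂ[X]} {φ ψ N : ι → ℂ} {c : ℂ} {m : ℕ}
    (hP' : CoeffTendsto P' l Q) (hF : CoeffTendsto F l G)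
    (hφ : Tendsto φ l (𝓝 c)) (hψ : Tendsto ψ l (𝓝 c))
    (hPd : ∀ᶠ i in l, (X - C (φ i)) ^ (m + 1) ∣ P i)
    (hPd' : ∀ᶠ i in l, (X - C (ψ i)) ^ (m + 1) ∣ P' i)
    (hPF : ∀ᶠ i in l, P i - P' i = C (N i) * F i) (hN : ∀ᶠ i in l, N i ≠ 0)
    (hQ : (Polynomial.derivative^[m + 1] Q).eval c ≠ 0) {k : ℕ} (hk : k < m) :
    (Polynomial.derivative^[k] G).IsRoot c := by
  have hFeval : ∀ j ≤ m, ∀ᶠ i in l, (Polynomial.derivative^[j] (F i)).eval (φ i) =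
      - ((Polynomial.derivative^[j] (P' i)).eval (φ i) / N i) := by
    intro j hj
    filter_upwards [hPd, hPF, hN] with i h1 h2 h3
    have h4 : (Polynomial.derivative^[j] (P i)).eval (φ i) = 0 := by
      rw [← IsRoot.def, ← dvd_iff_isRoot]
      exact (dvd_pow_self _ (by omega)).trans (pow_sub_dvd_iterate_derivative_of_pow_dvd j h1)
    have h5 := congrArg (fun p => (Polynomial.derivative^[j] p).eval (φ i)) h2
    simp only [iterate_derivative_sub, iterate_derivative_C_mul, eval_sub, eval_mul, eval_C, h4]
      at h5
    field_simp
    linear_combination -h5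
  have hdvd : ∀ j ≤ m, ∀ᶠ i in l,
      (X - C (ψ i)) ^ (m + 1 - j) ∣ Polynomial.derivative^[j] (P' i) := by
    intro j hj
    filter_upwards [hPd'] with i hi using pow_sub_dvd_iterate_derivative_of_pow_dvd j hi
  obtain ⟨r, hr⟩ : ∃ r, Tendsto (fun i => (φ i - ψ i) / N i) l (𝓝 r) := by
    have hH := (hP'.iterate_derivative m).divByMonic hψ
    have hroot : (Polynomial.derivative^[m] Q).IsRoot c := by
      rw [← dvd_iff_isRoot]
      refine (hP'.iterate_derivative m).X_sub_C_dvd hψ ?_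
      simpa using hdvd m le_rfl
    have hHc : (Polynomial.derivative^[m] Q /ₘ (X - C c)).eval c ≠ 0 := by
      rw [Function.iterate_succ_apply', ← mul_divByMonic_eq_iff_isRoot.2 hroot] at hQ
      simpa [derivative_mul] using hQ
    refine ⟨_, ((((hF.iterate_derivative m).eval hφ).neg).div (hH.eval hφ) hHc).congr' ?_⟩
    filter_upwards [hFeval m le_rfl, hdvd m le_rfl, hN, (hH.eval hφ).eventually_ne hHc] with
      i h1 h2 h3 h4
    rw [show m + 1 - m = 1 by omega, pow_one, dvd_iff_isRoot] at h2
    have h5 : (Polynomial.derivative^[m] (P' i)).eval (φ i) = (φ i - ψ i) *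
        (Polynomial.derivative^[m] (P' i) /ₘ (X - C (ψ i))).eval (φ i) := by
      conv_lhs => rw [← mul_divByMonic_eq_iff_isRoot.2 h2]
      simp
    simp only [Pi.div_apply]
    rw [h1, h5]
    field_simp
  have hK := ((hP'.iterate_derivative k).divByMonic hψ).divByMonic hψ
  refine tendsto_nhds_unique ((hF.iterate_derivative k).eval hφ) ?_
  have hlim := ((hr.mul (hφ.sub hψ)).mul (hK.eval hφ)).neg
  rw [sub_self, mul_zero, zero_mul, neg_zero] at hlim
  refine hlim.congr' ?_
  filter_upwards [hFeval k hk.le, hdvd k hk.le, hN] with i h1 h2 h3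
  obtain ⟨R, hR⟩ := (pow_dvd_pow _ (by omega : 2 ≤ m + 1 - k)).trans h2
  rw [pow_two, mul_assoc] at hR
  rw [h1, hR, mul_divByMonic_cancel_left _ (monic_X_sub_C _),
    mul_divByMonic_cancel_left _ (monic_X_sub_C _)]
  simp only [eval_mul, eval_sub, eval_X, eval_C]
  field_simp

/-- The lower-order part of `mcPoly`. -/
noncomputable def mcTail (d : ℕ) (a : Fin (d - 1) → ℂ) : ℂ[X] :=
  ∑ i : Fin (d - 1), C (a i) * X ^ (i : ℕ)

theorem degree_mcTail_lt (d : ℕ) (a : Fin (d - 1) → ℂ) :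
    (mcTail d a).degree < ((d - 1 : ℕ) : WithBot ℕ) :=
  degree_sum_fin_lt a

theorem degree_mcTail_lt' (d : ℕ) (a : Fin (d - 1) → ℂ) :
    (mcTail d a).degree < (d : WithBot ℕ) :=
  (degree_mcTail_lt d a).trans_le (by exact_mod_cast Nat.sub_le d 1)

theorem coeff_mcTail (d : ℕ) (a : Fin (d - 1) → ℂ) (j : Fin (d - 1)) :
    (mcTail d a).coeff j = a j := by
  simp [mcTail, coeff_X_pow, Fin.val_inj, Finset.sum_ite_eq]

theorem monic_mcPoly (d : ℕ) (a : Fin (d - 1) → ℂ) : (mcPoly d a).Monic :=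
  monic_X_pow_add (degree_mcTail_lt' d a)

theorem natDegree_mcPoly (d : ℕ) (a : Fin (d - 1) → ℂ) : (mcPoly d a).natDegree = d := by
  refine natDegree_eq_of_degree_eq_some ?_
  rw [mcPoly, degree_add_eq_left_of_degree_lt, degree_X_pow]
  rw [degree_X_pow]
  exact degree_mcTail_lt' d a

theorem mcPoly_sub_mcPoly (d : ℕ) (a b : Fin (d - 1) → ℂ) :
    mcPoly d a - mcPoly d b = mcTail d (a - b) := by
  simp [mcPoly, mcTail, sub_mul, Finset.sum_sub_distrib]

theorem mcTail_smul (d : ℕ) (r : ℂ) (a : Fin (d - 1) → ℂ) :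
    mcTail d (r • a) = C r * mcTail d a := by
  simp [mcTail, Finset.mul_sum, mul_assoc]

theorem coeffTendsto_mcTail {ι : Type*} {l : Filter ι} {d : ℕ} {a : ι → Fin (d - 1) → ℂ}
    {a₀ : Fin (d - 1) → ℂ} (ha : Tendsto a l (𝓝 a₀)) :
    CoeffTendsto (fun i => mcTail d (a i)) l (mcTail d a₀) := by
  refine ⟨⟨d, fun i => natDegree_le_of_degree_le (degree_mcTail_lt' d _).le⟩, fun k => ?_⟩
  simp only [mcTail, finsetSum_coeff, coeff_C_mul]
  exact tendsto_finsetSum _ fun j _ => ((tendsto_pi_nhds.1 ha) j).mul_const _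

theorem coeffTendsto_mcPoly {ι : Type*} {l : Filter ι} {d : ℕ} {a : ι → Fin (d - 1) → ℂ}
    {a₀ : Fin (d - 1) → ℂ} (ha : Tendsto a l (𝓝 a₀)) :
    CoeffTendsto (fun i => mcPoly d (a i)) l (mcPoly d a₀) := by
  refine ⟨⟨d, fun i => (natDegree_mcPoly d _).le⟩, fun k => ?_⟩
  simp only [mcPoly, coeff_add]
  exact ((coeffTendsto_mcTail ha).2 k).const_add _

/-- Near a polynomial, a polynomial with no more critical values than it is determined by its
critical value multiset. -/
theorem eventually_eq_of_cvl_eq {ι : Type*} {U : Ultrafilter ι} {d : ℕ} (hd : 2 ≤ d)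
    {a b : ι → Fin (d - 1) → ℂ} {a₀ : Fin (d - 1) → ℂ} (ha : Tendsto a U (𝓝 a₀))
    (hb : Tendsto b U (𝓝 a₀)) (hcvl : ∀ i, cvl (mcPoly d (a i)) = cvl (mcPoly d (b i)))
    (hcard : ∀ᶠ i in U, (cvl (mcPoly d (a i))).toFinset.card ≤ (cvl (mcPoly d a₀)).toFinset.card) :
    ∀ᶠ i in U, a i = b i := by
  by_contra hne
  rw [← Ultrafilter.eventually_not] at hne
  have hpa := coeffTendsto_mcPoly ha
  have hpb := coeffTendsto_mcPoly hb
  set Q := mcPoly d a₀ with hQdef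
  have hdeg : ∀ e : Fin (d - 1) → ℂ, (mcPoly d e).natDegree = d - 1 + 1 := fun e => by
    rw [natDegree_mcPoly]; omega
  have hdQ : Q.derivative ≠ 0 := derivative_ne_zero.2 (by rw [hQdef, hdeg]; omega)
  have htrack := fun c (hc : c ∈ Q.derivative.roots) => hpa.exists_critical_point
    (fun _ => monic_mcPoly d _) (fun _ => hdeg _) (monic_mcPoly d _) (hdeg _) hcard hc
  have htrack' := fun c (hc : c ∈ Q.derivative.roots) => hpb.exists_critical_point
    (fun _ => monic_mcPoly d _) (fun _ => hdeg _) (monic_mcPoly d _) (hdeg _)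
    (by simpa only [hcvl] using hcard) hc
  choose! φ hφ hφ' using htrack
  choose! ψ hψ hψ' using htrack'
  have hval : ∀ c ∈ Q.derivative.roots, ∀ᶠ i in U,
      (mcPoly d (a i)).eval (φ c i) = (mcPoly d (b i)).eval (ψ c i) := by
    have hsel : ∀ v ∈ (cvl Q).toFinset, ∃ x ∈ Q.derivative.roots, Q.eval x = v := by
      intro v hv
      rwa [Multiset.mem_toFinset, cvl, Multiset.mem_map] at hv
    choose! s hs hs' using hsel
    intro c hc
    have hmem : ∀ x ∈ Q.derivative.roots, ∀ᶠ i in U,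
        (mcPoly d (a i)).eval (φ x i) ∈ (cvl (mcPoly d (a i))).toFinset := by
      intro x hx
      filter_upwards [hφ' x hx] with i hi
      rw [Multiset.mem_toFinset]
      exact Multiset.mem_map_of_mem _ hi.1
    have hmem' : ∀ᶠ i in U,
        (mcPoly d (b i)).eval (ψ c i) ∈ (cvl (mcPoly d (a i))).toFinset := by
      filter_upwards [hψ' c hc] with i hi
      rw [Multiset.mem_toFinset, hcvl]
      exact Multiset.mem_map_of_mem _ hi.1
    have hx1 : ∀ v ∈ (cvl Q).toFinset, ∀ᶠ i in U,
        (mcPoly d (a i)).eval (φ (s v) i) ∈ (cvl (mcPoly d (a i))).toFinset :=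
      fun v hv => hmem _ (hs v hv)
    have hx2 : ∀ v ∈ (cvl Q).toFinset,
        Tendsto (fun i => (mcPoly d (a i)).eval (φ (s v) i)) U (𝓝 v) := fun v hv => by
      have := hpa.eval (hφ _ (hs v hv))
      rwa [hs' v hv] at this
    have h1 := eventually_eq_of_card_le hcard (x := fun v i => (mcPoly d (a i)).eval (φ (s v) i))
      hx1 hx2 (hmem c hc) (hpa.eval (hφ c hc))
    have h2 := eventually_eq_of_card_le hcard (x := fun v i => (mcPoly d (a i)).eval (φ (s v) i))
      hx1 hx2 hmem' (hpb.eval (hψ c hc))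
    filter_upwards [h1, h2] with i hi1 hi2 using hi1.trans hi2.symm
  obtain ⟨e, he, hlim⟩ := (isCompact_sphere (0 : Fin (d - 1) → ℂ) 1).ultrafilter_le_nhds
    (U.map fun i => ((‖a i - b i‖ : ℂ))⁻¹ • (a i - b i)) (by
      rw [le_principal_iff]
      change ∀ᶠ i in (U : Filter ι),
        (‖a i - b i‖ : ℂ)⁻¹ • (a i - b i) ∈ Metric.sphere (0 : Fin (d - 1) → ℂ) 1
      filter_upwards [hne] with i hi
      rw [mem_sphere_zero_iff_norm, norm_smul, norm_inv, Complex.norm_real, norm_norm,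
        inv_mul_cancel₀ (norm_ne_zero_iff.2 (sub_ne_zero.2 hi))])
  have hF := coeffTendsto_mcTail hlim
  have hG0 : mcTail d e ≠ 0 := by
    intro h0
    have : e = 0 := funext fun j => by rw [← coeff_mcTail d e j, h0]; simp
    rw [mem_sphere_zero_iff_norm, this, norm_zero] at he
    exact zero_ne_one he
  have hle : Q.derivative.roots ≤ (mcTail d e).roots := by
    rw [Multiset.le_iff_count]
    intro c
    by_cases hc : c ∈ Q.derivative.roots
    swap
    · rw [Multiset.count_eq_zero_of_notMem hc]; exact Nat.zero_le _
    rw [count_roots, count_roots]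
    set m := Q.derivative.rootMultiplicity c with hm
    have hm0 : 0 < m := (rootMultiplicity_pos hdQ).2 (isRoot_of_mem_roots hc)
    have hnz : (Polynomial.derivative^[m + 1] (Q - C (Q.eval c))).eval c ≠ 0 := by
      rw [Function.iterate_succ_apply, derivative_sub, derivative_C, sub_zero]
      intro h0
      refine lt_irrefl m (lt_rootMultiplicity_of_isRoot_iterate_derivative hdQ fun k hk => ?_)
      rcases hk.lt_or_eq with hk | rfl
      · exact isRoot_iterate_derivative_of_lt_rootMultiplicity hk
      · exact h0
    have key : ∀ k < m, (Polynomial.derivative^[k] (mcTail d e)).IsRoot c := fun k hk =>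
      CoeffTendsto.isRoot_iterate_derivative_of_dvd
        (P := fun i => mcPoly d (a i) - C ((mcPoly d (a i)).eval (φ c i)))
        (N := fun i => (‖a i - b i‖ : ℂ))
        (hpb.sub_C (hpb.eval (hψ c hc))) hF (hφ c hc) (hψ c hc)
        ((hφ' c hc).mono fun i hi => hi.2) ((hψ' c hc).mono fun i hi => hi.2)
        (by
          filter_upwards [hval c hc, hne] with i hi hi'
          have hn : (‖a i - b i‖ : ℂ) ≠ 0 := by
            exact_mod_cast norm_ne_zero_iff.2 (sub_ne_zero.2 hi')
          rw [hi, sub_sub_sub_cancel_right, mcPoly_sub_mcPoly, ← mcTail_smul,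
            smul_inv_smul₀ hn])
        (hne.mono fun i hi => by
          exact_mod_cast norm_ne_zero_iff.2 (sub_ne_zero.2 hi))
        hnz hk
    have := lt_rootMultiplicity_of_isRoot_iterate_derivative (n := m - 1) hG0
      fun k hk => key k (by omega)
    omega
  have h1 := Multiset.card_le_card hle
  rw [← (IsAlgClosed.splits _).natDegree_eq_card_roots, natDegree_derivative, hQdef, hdeg] at h1
  have h2 := (Nat.cast_le (α := WithBot ℕ)).2 (h1.trans (card_roots' _))
  have h3 := degree_mcTail_lt d e
  rw [degree_eq_natDegree hG0] at h3
  exact absurd (h2.trans_lt h3) (by simp)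

theorem card_mshape {X : Type*} [DecidableEq X] (M : Multiset X) :
    Multiset.card (mshape M) = M.toFinset.card := by
  rw [mshape, Multiset.card_map, ← Finset.card_def]
  congr!

theorem IsMergeOf.card_le {μ lam : Multiset ℕ} (h : IsMergeOf μ lam) :
    Multiset.card μ ≤ Multiset.card lam := by
  obtain ⟨m, hm, rfl, rfl⟩ := h
  rw [Multiset.card_map, Multiset.card_join]
  have : ∀ x ∈ m.map Multiset.card, 1 ≤ x := by
    intro x hx
    obtain ⟨s, hs, rfl⟩ := Multiset.mem_map.1 hx
    exact Multiset.card_pos.2 (hm s hs)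
  simpa using Multiset.card_nsmul_le_sum this

/-- A multiset path of critical values with weakly increasing shape has a unique lift
through the Lyashko–Looijenga map with a given polynomial start point. -/
theorem stmt_11 (d : ℕ) (hd : 2 ≤ d)
    (a₁ a₂ : Set.Icc (0:ℝ) 1 → (Fin (d - 1) → ℂ))
    (h₁ : Continuous a₁) (h₂ : Continuous a₂)
    (h0 : a₁ ⟨0, by norm_num⟩ = a₂ ⟨0, by norm_num⟩)
    (hcvl : ∀ t, cvl (mcPoly d (a₁ t)) = cvl (mcPoly d (a₂ t)))
    (hinc : ∀ s t : Set.Icc (0:ℝ) 1, s ≤ t →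
      IsMergeOf (mshape (cvl (mcPoly d (a₁ t)))) (mshape (cvl (mcPoly d (a₁ s))))) :
    a₁ = a₂ := by
  have hclosed : IsClosed
      {t : ℝ | Set.IccExtend zero_le_one a₁ t = Set.IccExtend zero_le_one a₂ t} :=
    isClosed_eq h₁.Icc_extend' h₂.Icc_extend'
  have hsub : Set.Icc (0 : ℝ) 1 ⊆
      {t : ℝ | Set.IccExtend zero_le_one a₁ t = Set.IccExtend zero_le_one a₂ t} := by
    refine (hclosed.inter isClosed_Icc).Icc_subset_of_forall_mem_nhdsWithin ?_ ?_
    · simpa [Set.IccExtend_left] using h0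
    · rintro x ⟨hx, -⟩
      rw [mem_iff_ultrafilter]
      intro U hU
      have hU' : (U : Filter ℝ) ≤ 𝓝 x := hU.trans nhdsWithin_le_nhds
      refine eventually_eq_of_cvl_eq hd ((h₁.Icc_extend'.tendsto x).mono_left hU') ?_
        (fun t => hcvl _) ?_
      · rw [Set.mem_ofPred_eq] at hx
        rw [hx]
        exact (h₂.Icc_extend'.tendsto x).mono_left hU'
      · filter_upwards [hU self_mem_nhdsWithin] with t ht
        have := (hinc _ _ (Set.monotone_projIcc zero_le_one (le_of_lt ht))).card_le
        rwa [card_mshape, card_mshape] at this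
  funext t
  simpa using hsub t.2
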